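/- arXiv:1606.03380 — 2 statements merged into one kernel-verified Lean document; each statement's English description precedes it below -/
import Mathlib

section
/- Let Ξ = U_Ξ Λ_Ξ U_Ξ^H and Ω = U_Ω Λ_Ω U_Ω^H be N × N complex matrices with U_Ξ, U_Ω unitary and Λ_Ξ, Λ_Ω diagonal with real diagonal entries, and assume the diagonal entries of Λ_Ξ are pairwise distinct and nonzero and the diagonal entries of Λ_Ω are pairwise distinct and nonzero. If κ ∈ ℝ and B ∈ ℂ^{N×N} satisfy κ B = Ξ B Ω, then there exist a diagonal matrix Λ ∈ ℂ^{N×N} and a permutation matrix Π such that B = U_Ξ Λ Π U_Ω^H. In particular, B admits a singular-value-type factorization whose left unitary factor is U_Ξ, the eigenvector matrix of Ξ. -/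
open Matrix

/-- A matrix with at most one nonzero entry in each row and in each column has its support
contained in the graph of a permutation. -/
lemma exists_perm_of_support {n R : Type*} [Fintype n] [DecidableEq n] [Zero R]
    (C : Matrix n n R)
    (hrow : ∀ i j k, C i j ≠ 0 → C i k ≠ 0 → j = k)
    (hcol : ∀ i j k, C i k ≠ 0 → C j k ≠ 0 → i = j) :
    ∃ σ : Equiv.Perm n, ∀ i j, C i j ≠ 0 → σ i = j := by
  classical
  let s : Finset n := Finset.univ.filter fun i => ∃ j, C i j ≠ 0
  have hs : ∀ i, ∃ j, i ∈ s → C i j ≠ 0 := fun i => by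
    by_cases hi : ∃ j, C i j ≠ 0
    · obtain ⟨j, hj⟩ := hi
      exact ⟨j, fun _ => hj⟩
    · exact ⟨i, fun h => absurd (Finset.mem_filter.mp h).2 hi⟩
  choose f hf using hs
  have hinj : Set.InjOn f s := fun i hi j hj hij =>
    hcol i j (f i) (hf i hi) (hij ▸ hf j hj)
  obtain ⟨g, hg⟩ := Finset.exists_equiv_extend_of_card_eq (t := Finset.univ)
    Finset.card_univ.symm (Finset.subset_univ (s.image f)) hinj
  refine ⟨g.trans (Equiv.subtypeUnivEquiv Finset.mem_univ), fun i j hij => ?_⟩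
  have hi : i ∈ s := Finset.mem_filter.mpr ⟨Finset.mem_univ i, j, hij⟩
  exact (hg i hi).trans (hrow i _ _ (hf i hi) hij)

/-- A matrix supported on the graph of a permutation is a diagonal matrix times the matrix of
that permutation. -/
lemma eq_diagonal_mul_permMatrix {n R : Type*} [Fintype n] [DecidableEq n]
    [NonAssocSemiring R] (C : Matrix n n R) (σ : Equiv.Perm n)
    (hσ : ∀ i j, C i j ≠ 0 → σ i = j) :
    C = diagonal (fun i => C i (σ i)) * σ.permMatrix R := by
  ext i j
  rw [diagonal_mul, Equiv.Perm.permMatrix, PEquiv.toMatrix_apply, Equiv.toPEquiv_apply]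
  by_cases h : σ i = j
  · simp [h]
  · simpa [h] using not_imp_comm.mp (hσ i j) h

/-- If `κ C = diag(a) C diag(b)` with `a`, `b` injective and nowhere zero, then the support of
`C` lies on the graph of a permutation. -/
lemma exists_perm_of_smul_eq_diagonal_mul {n K : Type*} [Fintype n] [DecidableEq n] [Field K]
    {a b : n → K} (ha : Function.Injective a) (ha0 : ∀ i, a i ≠ 0)
    (hb : Function.Injective b) (hb0 : ∀ i, b i ≠ 0)
    {κ : K} {C : Matrix n n K} (hC : κ • C = diagonal a * C * diagonal b) :
    ∃ σ : Equiv.Perm n, ∀ i j, C i j ≠ 0 → σ i = j := by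
  have key : ∀ i j, C i j ≠ 0 → κ = a i * b j := fun i j hij => by
    have h := congrFun (congrFun hC i) j
    rw [mul_diagonal, diagonal_mul, Matrix.smul_apply, smul_eq_mul] at h
    exact mul_right_cancel₀ hij (by rw [h]; ring)
  refine exists_perm_of_support C (fun i j k hj hk => hb ?_) (fun i j k hi hj => ha ?_)
  · exact mul_left_cancel₀ (ha0 i) ((key i j hj).symm.trans (key i k hk))
  · exact mul_right_cancel₀ (hb0 k) ((key i k hi).symm.trans (key j k hj))

/-- **Structure of the optimal precoder (Proposition 2).**
If `Ξ = U_Ξ Λ_Ξ U_Ξᴴ` and `Ω = U_Ω Λ_Ω U_Ωᴴ` with unitary `U_Ξ, U_Ω` and real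
diagonal `Λ_Ξ, Λ_Ω` whose diagonal entries are pairwise distinct and nonzero,
and `κ B = Ξ B Ω`, then `B = U_Ξ Λ Π U_Ωᴴ` for some diagonal `Λ` and some
permutation matrix `Π`; in particular the left unitary factor of `B` is `U_Ξ`. -/
theorem optimal_precoder_structure
    {N : ℕ}
    (UΞ UΩ : Matrix (Fin N) (Fin N) ℂ)
    (hUΞ : UΞᴴ * UΞ = 1 ∧ UΞ * UΞᴴ = 1)
    (hUΩ : UΩᴴ * UΩ = 1 ∧ UΩ * UΩᴴ = 1)
    (lamΞ lamΩ : Fin N → ℝ)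
    (hlamΞ_inj : Function.Injective lamΞ) (hlamΞ_ne : ∀ m, lamΞ m ≠ 0)
    (hlamΩ_inj : Function.Injective lamΩ) (hlamΩ_ne : ∀ n, lamΩ n ≠ 0)
    (Ξ Om : Matrix (Fin N) (Fin N) ℂ)
    (hΞ : Ξ = UΞ * Matrix.diagonal (fun m => ((lamΞ m : ℝ) : ℂ)) * UΞᴴ)
    (hOm : Om = UΩ * Matrix.diagonal (fun n => ((lamΩ n : ℝ) : ℂ)) * UΩᴴ)
    (κ : ℝ) (B : Matrix (Fin N) (Fin N) ℂ)
    (hB : (κ : ℂ) • B = Ξ * B * Om) :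
    ∃ (lam : Fin N → ℂ) (σ : Equiv.Perm (Fin N)),
      B = UΞ * Matrix.diagonal lam * σ.permMatrix ℂ * UΩᴴ := by
  have hC : (κ : ℂ) • (UΞᴴ * B * UΩ) =
      diagonal (fun m => (lamΞ m : ℂ)) * (UΞᴴ * B * UΩ) * diagonal (fun n => (lamΩ n : ℂ)) := by
    calc (κ : ℂ) • (UΞᴴ * B * UΩ) = UΞᴴ * ((κ : ℂ) • B) * UΩ := by simp
      _ = (UΞᴴ * UΞ) * diagonal (fun m => (lamΞ m : ℂ)) * (UΞᴴ * B * UΩ) *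
          diagonal (fun n => (lamΩ n : ℂ)) * (UΩᴴ * UΩ) := by
        rw [hB, hΞ, hOm]
        simp only [Matrix.mul_assoc]
      _ = _ := by rw [hUΞ.1, hUΩ.1, Matrix.one_mul, Matrix.mul_one]
  obtain ⟨σ, hσ⟩ := exists_perm_of_smul_eq_diagonal_mul
    (Complex.ofReal_injective.comp hlamΞ_inj) (fun m => Complex.ofReal_ne_zero.mpr (hlamΞ_ne m))
    (Complex.ofReal_injective.comp hlamΩ_inj) (fun n => Complex.ofReal_ne_zero.mpr (hlamΩ_ne n))
    hC
  refine ⟨fun i => (UΞᴴ * B * UΩ) i (σ i), σ, ?_⟩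
  rw [Matrix.mul_assoc UΞ, ← eq_diagonal_mul_permMatrix _ σ hσ]
  calc B = (UΞ * UΞᴴ) * B * (UΩ * UΩᴴ) := by
        rw [hUΞ.2, hUΩ.2, Matrix.one_mul, Matrix.mul_one]
    _ = _ := by simp only [Matrix.mul_assoc]
end

section
/- Let λ_r ∈ ℝ^{N_r} and λ_t ∈ ℝ^{N_t} have nonnegative entries, let U_R and U_T be unitary, let G̃ be the N_r × N_t matrix with [G̃]_{nm} = √(λ_{r,n} λ_{t,m}), and let W be a random N_r × N_t matrix with E[W_{nm}] = 0 and E[W_{nm} conj(W_{n'm'})] = δ_{nn'} δ_{mm'}. Define H = U_R (G̃ ⊙ W) U_T^H, A_R = U_R diag(λ_r) U_R^H, and A_T = U_T diag(λ_t) U_T^H. Then for all indices a, a' ∈ {1,…,N_r} and b, b' ∈ {1,…,N_t}: E[ [H]_{ab} · conj([H]_{a'b'}) ] = [A_R]_{aa'} · [A_T]_{b'b}. That is, H has the same second-order statistics as the Kronecker-model channel A_R^{1/2} W A_T^{1/2}. -/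
open MeasureTheory Matrix
open scoped ComplexConjugate

/-- Second moments of linear combinations of uncorrelated variables with unit second moment. -/
theorem integral_sum_mul_conj_sum_of_uncorrelated {ι Ω : Type*} [Fintype ι] [DecidableEq ι]
    [MeasurableSpace Ω] {μ : Measure Ω} {X : Ω → ι → ℂ}
    (hint : ∀ i j, Integrable (fun ω => X ω i * conj (X ω j)) μ)
    (hcov : ∀ i j, ∫ ω, X ω i * conj (X ω j) ∂μ = if i = j then 1 else 0) (c d : ι → ℂ) :
    ∫ ω, (∑ i, c i * X ω i) * conj (∑ i, d i * X ω i) ∂μ = ∑ i, c i * conj (d i) := by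
  have expand : ∀ ω, (∑ i, c i * X ω i) * conj (∑ i, d i * X ω i)
      = ∑ i, ∑ j, c i * conj (d j) * (X ω i * conj (X ω j)) := fun ω => by
    simp only [map_sum, map_mul, Finset.sum_mul_sum]
    exact Finset.sum_congr rfl fun i _ => Finset.sum_congr rfl fun j _ => by ring
  simp_rw [expand]
  rw [integral_finsetSum _ fun i _ => integrable_finsetSum _ fun j _ => (hint i j).const_mul _]
  refine Finset.sum_congr rfl fun i _ => ?_
  rw [integral_finsetSum _ fun j _ => (hint i j).const_mul _]
  simp [integral_const_mul, hcov]

/-- Entries of a matrix triple product with a Hadamard product in the middle. -/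
theorem mul_hadamard_mul_conjTranspose_apply {l m n o : Type*} [Fintype m] [Fintype n]
    (U : Matrix l m ℂ) (G X : Matrix m n ℂ) (V : Matrix o n ℂ) (a : l) (b : o) :
    (U * hadamard G X * Vᴴ) a b
      = ∑ p : m × n, U a p.1 * G p.1 p.2 * conj (V b p.2) * X p.1 p.2 := by
  simp only [Matrix.mul_apply, hadamard_apply, conjTranspose_apply, Finset.sum_mul]
  rw [Finset.sum_comm, Fintype.sum_prod_type]
  refine Finset.sum_congr rfl fun i _ => Finset.sum_congr rfl fun j _ => ?_
  simp only [RCLike.star_def]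
  ring

/-- **Second-order equivalence with the Kronecker channel model.**
With the rank-one coupling `[G̃]_{nm} = √(λ_{r,n} λ_{t,m})` and
`H = U_R (G̃ ⊙ W) U_Tᴴ`, one has
`E[[H]_{ab} conj([H]_{a'b'})] = [A_R]_{aa'} [A_T]_{b'b}` where
`A_R = U_R diag(λ_r) U_Rᴴ` and `A_T = U_T diag(λ_t) U_Tᴴ`; i.e. `H` has the
same second-order statistics as the Kronecker channel `A_R^{1/2} W A_T^{1/2}`. -/
theorem kronecker_second_order_statistics
    {Nr Nt : ℕ}
    {Ω : Type*} [MeasurableSpace Ω] (μ : Measure Ω) [IsProbabilityMeasure μ]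
    (lamr : Fin Nr → ℝ) (hlamr : ∀ n, 0 ≤ lamr n)
    (lamt : Fin Nt → ℝ) (hlamt : ∀ m, 0 ≤ lamt m)
    (UR : Matrix (Fin Nr) (Fin Nr) ℂ) (hUR : URᴴ * UR = 1 ∧ UR * URᴴ = 1)
    (UT : Matrix (Fin Nt) (Fin Nt) ℂ) (hUT : UTᴴ * UT = 1 ∧ UT * UTᴴ = 1)
    (Gt : Matrix (Fin Nr) (Fin Nt) ℝ)
    (hGt : ∀ n m, Gt n m = Real.sqrt (lamr n * lamt m))
    (W : Ω → Matrix (Fin Nr) (Fin Nt) ℂ)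
    (hWmeas : ∀ n m, Measurable fun ω => W ω n m)
    (hWmean : ∀ n m, ∫ ω, W ω n m ∂μ = 0)
    (hWint : ∀ n m n' m', Integrable (fun ω => W ω n m * conj (W ω n' m')) μ)
    (hWcov : ∀ n m n' m',
      ∫ ω, W ω n m * conj (W ω n' m') ∂μ = if n = n' ∧ m = m' then 1 else 0)
    (H : Ω → Matrix (Fin Nr) (Fin Nt) ℂ)
    (hH : ∀ ω, H ω = UR * (Matrix.hadamard (Gt.map (fun x => (x : ℂ))) (W ω)) * UTᴴ)
    (AR : Matrix (Fin Nr) (Fin Nr) ℂ)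
    (hAR : AR = UR * Matrix.diagonal (fun n => ((lamr n : ℝ) : ℂ)) * URᴴ)
    (AT : Matrix (Fin Nt) (Fin Nt) ℂ)
    (hAT : AT = UT * Matrix.diagonal (fun m => ((lamt m : ℝ) : ℂ)) * UTᴴ) :
    ∀ (a a' : Fin Nr) (b b' : Fin Nt),
      ∫ ω, H ω a b * conj (H ω a' b') ∂μ = AR a a' * AT b' b := by
  intro a a' b b'
  have coupling_sq : ∀ n m, (Gt n m : ℂ) * Gt n m = lamr n * lamt m := fun n m => by
    rw [hGt]
    exact_mod_cast Real.mul_self_sqrt (mul_nonneg (hlamr n) (hlamt m))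
  simp_rw [hH, mul_hadamard_mul_conjTranspose_apply]
  rw [integral_sum_mul_conj_sum_of_uncorrelated (X := fun ω (p : Fin Nr × Fin Nt) => W ω p.1 p.2)
    (fun p q => hWint p.1 p.2 q.1 q.2)
    (fun p q => by simp only [hWcov, Prod.ext_iff])]
  rw [hAR, hAT, Matrix.mul_apply, Matrix.mul_apply, Finset.sum_mul_sum, Fintype.sum_prod_type]
  refine Finset.sum_congr rfl fun n _ => Finset.sum_congr rfl fun m _ => ?_
  simp only [mul_diagonal, conjTranspose_apply, RCLike.star_def, map_apply, map_mul,
    Complex.conj_conj, Complex.conj_ofReal]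
  linear_combination
    UR a n * conj (UT b m) * conj (UR a' n) * UT b' m * coupling_sq n m
end
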